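/- (Corollary 2: Conway's circle for odd tangential polygons.) Let n ≥ 3 be odd and let V₁, …, Vₙ (indexed cyclically) be the vertices of a convex tangential polygon with incenter I, inradius r > 0, and side lengths λ_i = dist V_i V_{i+1} (indices mod n, so λ_n = dist V_n V₁). For each k ∈ {1, …, n} define L_k = Σ{λ_i : 1 ≤ i < k, i odd} + Σ{λ_i : k < i ≤ n, i even} if k is odd, and L_k = Σ{λ_i : 1 ≤ i < k, i even} + Σ{λ_i : k < i ≤ n, i odd} if k is even. For each k form the two points obtained by extending both sides through V_k beyond V_k by length L_k: the point V_k + (L_k / λ_k) • (V_k - V_{k+1}) and the point V_k + (L_k / λ_{k-1}) • (V_k - V_{k-1}). Then all 2n resulting points are equidistant from I, i.e., they lie on a common circle centered at the incenter I. -/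

import Mathlib

noncomputable section

/-- The Euclidean plane. -/
abbrev Pt : Type := EuclideanSpace ℝ (Fin 2)

/-- The tangent length from `X` to the circle with center `I` and radius `r`. -/
def tangentLength (I : Pt) (r : ℝ) (X : Pt) : ℝ := √(dist I X ^ 2 - r ^ 2)

/-- If a point `T` of the line `AB` realizes the distance from `I` to the line, then `I - T` is
orthogonal to the direction of the line. -/
theorem inner_sub_eq_zero_of_dist_eq_infDist {A B I T : Pt}
    (hT : T ∈ affineSpan ℝ {A, B})
    (hd : dist I T = Metric.infDist I (affineSpan ℝ {A, B} : Set Pt)) :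
    inner ℝ (I - T) (B - A) = 0 := by
  by_cases hAB : B - A = 0
  · simp [hAB]
  have hpos : 0 < ‖B - A‖ ^ 2 := by positivity
  set y : ℝ := inner ℝ (I - T) (B - A) / ‖B - A‖ ^ 2 with hy
  have hmem : T + y • (B - A) ∈ affineSpan ℝ {A, B} := by
    rw [add_comm]
    exact AffineSubspace.vadd_mem_of_mem_direction
      (Submodule.smul_mem _ _ (AffineSubspace.vsub_mem_direction
        (right_mem_affineSpan_pair ℝ A B) (left_mem_affineSpan_pair ℝ A B))) hT
  have hle : ‖I - T‖ ≤ ‖(I - T) - y • (B - A)‖ := by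
    have h := Metric.infDist_le_dist_of_mem (x := I) (SetLike.mem_coe.2 hmem)
    rw [← hd, dist_eq_norm, dist_eq_norm, ← sub_sub] at h
    exact h
  have hsq := pow_le_pow_left₀ (norm_nonneg _) hle 2
  rw [norm_sub_sq_real (I - T), inner_smul_right, norm_smul, mul_pow, Real.norm_eq_abs, sq_abs]
    at hsq
  have hyi : inner ℝ (I - T) (B - A) = y * ‖B - A‖ ^ 2 := by
    rw [hy]; field_simp
  rw [hyi] at hsq ⊢
  have hz : y ^ 2 * ‖B - A‖ ^ 2 ≤ 0 := by nlinarith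
  have hy0 : y ^ 2 = 0 := le_antisymm (nonpos_of_mul_nonpos_left hz hpos) (sq_nonneg y)
  rw [pow_eq_zero_iff two_ne_zero |>.1 hy0, zero_mul]

/-- Extending the tangent side `BA` beyond `A` by `c` gives a point whose distance to the center
depends only on the tangent length from `A` and on `c`. -/
theorem dist_extend_of_tangent {A B I T : Pt} {r : ℝ} (hT : Sbtw ℝ A T B)
    (hd : dist I T = r) (hinf : Metric.infDist I (affineSpan ℝ {A, B} : Set Pt) = r) :
    dist A T = tangentLength I r A ∧
      ∀ c : ℝ, dist I (A + (c / dist A B) • (A - B)) = √(r ^ 2 + (tangentLength I r A + c) ^ 2) := by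
  have hAB : 0 < dist A B := dist_pos.2 hT.left_ne_right
  have hperp := inner_sub_eq_zero_of_dist_eq_infDist hT.wbtw.mem_affineSpan (hd.trans hinf.symm)
  obtain ⟨s, ⟨hs, -⟩, rfl⟩ := hT.wbtw
  set T := AffineMap.lineMap A B s with hTdef
  have hTA : T = A + s • (B - A) := by
    rw [hTdef, AffineMap.lineMap_apply, vsub_eq_sub, vadd_eq_add, add_comm]
  have hpyth (c : ℝ) : dist I (A + (c / dist A B) • (A - B)) ^ 2 =
      r ^ 2 + (s * dist A B + c) ^ 2 := by
    have h : I - (A + (c / dist A B) • (A - B)) = (I - T) + (s + c / dist A B) • (B - A) := by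
      rw [hTA]; module
    rw [dist_eq_norm, h, norm_add_sq_real, inner_smul_right, hperp, norm_smul, mul_pow,
      Real.norm_eq_abs, sq_abs, ← dist_eq_norm, hd, ← dist_eq_norm, dist_comm B A]
    field_simp
    ring
  have hAT : dist A T = s * dist A B := by
    rw [dist_left_lineMap, Real.norm_of_nonneg hs]
  have htl : tangentLength I r A = s * dist A B := by
    have h := hpyth 0
    simp only [zero_div, zero_smul, add_zero] at h
    rw [tangentLength, h, add_sub_cancel_left, Real.sqrt_sq (by positivity)]
  refine ⟨hAT.trans htl.symm, fun c => ?_⟩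
  rw [htl, ← hpyth c, Real.sqrt_sq dist_nonneg]

/-- Summing `t i + t (i + 1)` over every other `i` in an interval of even length gives the sum of
`t` over the interval. -/
theorem sum_Ico_filter_add_succ (t : ℕ → ℝ) (p : ℕ → Prop) [DecidablePred p] (a b : ℕ)
    (hp : ∀ i, p i ↔ (Even i ↔ Even a)) :
    ∑ i ∈ (Finset.Ico a (a + 2 * b)).filter p, (t i + t (i + 1)) =
      ∑ i ∈ Finset.Ico a (a + 2 * b), t i := by
  rw [Finset.sum_filter]
  induction b with
  | zero => simp
  | succ b ih =>
    have h0 : p (a + 2 * b) := by rw [hp]; grind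
    have h1 : ¬ p (a + 2 * b + 1) := by rw [hp]; grind
    rw [show a + 2 * (b + 1) = a + 2 * b + 1 + 1 by ring,
      Finset.sum_Ico_succ_top (by lia), Finset.sum_Ico_succ_top (by lia),
      Finset.sum_Ico_succ_top (by lia), Finset.sum_Ico_succ_top (by lia), ih, if_pos h0, if_neg h1]
    ring

/-- Deleting one index from a cyclic sequence of odd length, the alternating sum of
consecutive-pair sums covers every remaining term exactly once. -/
theorem alternating_sum_add_eq (t : ℕ → ℝ) {n k : ℕ} (hn : Odd n) (ht : t (n + 1) = t 1)
    (hk : 1 ≤ k) (hkn : k ≤ n) :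
    t k + (if Odd k then
        (∑ i ∈ (Finset.Ico 1 k).filter (fun i => Odd i), (t i + t (i + 1))) +
          (∑ i ∈ (Finset.Ioc k n).filter (fun i => Even i), (t i + t (i + 1)))
      else
        (∑ i ∈ (Finset.Ico 1 k).filter (fun i => Even i), (t i + t (i + 1))) +
          (∑ i ∈ (Finset.Ioc k n).filter (fun i => Odd i), (t i + t (i + 1)))) =
      ∑ i ∈ Finset.Ico 1 (n + 1), t i := by
  have hIoc : Finset.Ioc k n = Finset.Ico (k + 1) (n + 1) := by ext; simp
  have htotal : ∑ i ∈ Finset.Ico 1 (n + 1), t i =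
      ∑ i ∈ Finset.Ico 1 k, t i + (t k + ∑ i ∈ Finset.Ico (k + 1) (n + 1), t i) := by
    rw [← Finset.sum_Ico_consecutive t hk (show k ≤ n + 1 by lia),
      Finset.sum_eq_sum_Ico_succ_bot (show k < n + 1 by lia)]
  rw [hIoc, htotal]
  split_ifs with hodd
  · obtain ⟨a, ha⟩ : ∃ a, k = 1 + 2 * a := by obtain ⟨a, rfl⟩ := hodd; exact ⟨a, by ring⟩
    obtain ⟨b, hb⟩ : ∃ b, n + 1 = k + 1 + 2 * b := by
      obtain ⟨m, rfl⟩ := hn; exact ⟨m - a, by lia⟩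
    have h1 := sum_Ico_filter_add_succ t (fun i => Odd i) 1 a (by grind)
    have h2 := sum_Ico_filter_add_succ t (fun i => Even i) (k + 1) b (by grind)
    rw [← ha] at h1
    rw [← hb] at h2
    rw [h1, h2]
    ring
  · have heven := Nat.not_odd_iff_even.1 hodd
    obtain ⟨a, ha⟩ : ∃ a, k = 2 + 2 * a := by
      obtain ⟨a, rfl⟩ := heven; exact ⟨a - 1, by lia⟩
    obtain ⟨b, hb⟩ : ∃ b, n + 1 + 1 = k + 1 + 2 * b := by
      obtain ⟨m, rfl⟩ := hn; exact ⟨m - a, by lia⟩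
    have h1 := sum_Ico_filter_add_succ t (fun i => Even i) 2 a (by grind)
    have h2 := sum_Ico_filter_add_succ t (fun i => Odd i) (k + 1) b (by grind)
    have hn' : ¬ Odd (n + 1) := by grind
    rw [← ha] at h1
    rw [← hb, Finset.sum_filter, Finset.sum_Ico_succ_top (by lia), if_neg hn', add_zero,
      ← Finset.sum_filter, Finset.sum_Ico_succ_top (by lia), ht] at h2
    rw [h2, Finset.sum_filter, Finset.sum_eq_sum_Ico_succ_bot (show 1 < k by lia),
      if_neg (by decide), zero_add, ← Finset.sum_filter, h1,
      Finset.sum_eq_sum_Ico_succ_bot (show 1 < k by lia)]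
    ring

/-- **Corollary 2: Conway's circle for odd tangential polygons.**
For an odd convex tangential polygon `V₁, …, Vₙ` (indexed cyclically via
`ZMod n`) with incenter `I` and inradius `r`, extending both sides through the
`k`-th vertex by the alternating-parity sum `L k` of the other side lengths
produces `2n` points equidistant from `I`. -/
theorem conway_circle_odd_polygon
    (n : ℕ) (hn : 3 ≤ n) (hnodd : Odd n)
    (V : ZMod n → Pt) (I : Pt) (r : ℝ) (hr : 0 < r)
    (hne : ∀ i : ZMod n, V i ≠ V (i + 1))
    (htangent : ∀ i : ZMod n, ∃ T : Pt, Sbtw ℝ (V i) T (V (i + 1)) ∧ dist I T = r ∧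
      Metric.infDist I (affineSpan ℝ {V i, V (i + 1)} : Set Pt) = r)
    (hconvex : ∀ i j : ZMod n, j ≠ i → j ≠ i + 1 →
      (affineSpan ℝ {V i, V (i + 1)}).SSameSide I (V j))
    (lam : ℕ → ℝ)
    (hlam : ∀ i : ℕ, lam i = dist (V (i : ZMod n)) (V ((i : ZMod n) + 1)))
    (L : ℕ → ℝ)
    (hL : ∀ k : ℕ, L k =
      if Odd k then
        (∑ i ∈ (Finset.Ico 1 k).filter (fun i => Odd i), lam i) +
          (∑ i ∈ (Finset.Ioc k n).filter (fun i => Even i), lam i)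
      else
        (∑ i ∈ (Finset.Ico 1 k).filter (fun i => Even i), lam i) +
          (∑ i ∈ (Finset.Ioc k n).filter (fun i => Odd i), lam i)) :
    ∃ ρ : ℝ, ∀ k : ℕ, 1 ≤ k → k ≤ n →
      dist I (V (k : ZMod n) +
        (L k / lam k) • (V (k : ZMod n) - V ((k : ZMod n) + 1))) = ρ ∧
      dist I (V (k : ZMod n) +
        (L k / lam (k - 1)) • (V (k : ZMod n) - V ((k : ZMod n) - 1))) = ρ := by
  have hside (i : ZMod n) : dist (V i) (V (i + 1)) =
      tangentLength I r (V i) + tangentLength I r (V (i + 1)) ∧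
      (∀ c : ℝ, dist I (V i + (c / dist (V i) (V (i + 1))) • (V i - V (i + 1))) =
        √(r ^ 2 + (tangentLength I r (V i) + c) ^ 2)) ∧
      ∀ c : ℝ, dist I (V (i + 1) + (c / dist (V i) (V (i + 1))) • (V (i + 1) - V i)) =
        √(r ^ 2 + (tangentLength I r (V (i + 1)) + c) ^ 2) := by
    obtain ⟨T, hT, hd, hinf⟩ := htangent i
    obtain ⟨h1, h2⟩ := dist_extend_of_tangent hT hd hinf
    obtain ⟨h3, h4⟩ := dist_extend_of_tangent hT.symm hd (by rwa [Set.pair_comm])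
    rw [dist_comm (V (i + 1)) (V i)] at h4
    refine ⟨?_, h2, h4⟩
    rw [← h1, ← h3, dist_comm (V (i + 1)) T, hT.wbtw.dist_add_dist]
  let t : ℕ → ℝ := fun k => tangentLength I r (V k)
  have hlt (i : ℕ) : lam i = t i + t (i + 1) := by
    rw [hlam, (hside i).1]
    simp [t]
  have hsum (k : ℕ) (hk : 1 ≤ k) (hkn : k ≤ n) :
      t k + L k = ∑ i ∈ Finset.Ico 1 (n + 1), t i := by
    rw [hL k, ← alternating_sum_add_eq t hnodd (by simp [t]) hk hkn]
    simp only [hlt]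
  refine ⟨√(r ^ 2 + (∑ i ∈ Finset.Ico 1 (n + 1), t i) ^ 2), fun k hk hkn => ⟨?_, ?_⟩⟩
  · rw [hlam, (hside k).2.1, ← hsum k hk hkn]
  · have h := (hside ((k : ZMod n) - 1)).2.2 (L k)
    rw [sub_add_cancel] at h
    rw [hlam, Nat.cast_sub hk, Nat.cast_one, sub_add_cancel, h, ← hsum k hk hkn]
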